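/- arXiv:1408.6765 — 3 statements merged into one kernel-verified Lean document; each statement's English description precedes it below -/
import Mathlib

section
/- Let p, q be positive integers, let U be an open subset of ℝ^p × ℝ^q, and let φ = (φ¹, φ²) : U → ℝ^p × ℝ^q be a C¹ map. Suppose that at a point (a,b) ∈ U the partial derivative of φ² in the second variable, i.e. the linear map v ↦ Dφ(a,b)(0,v) projected to the second factor ℝ^q, is an invertible linear map of ℝ^q. Then φ is locally decomposable at (a,b): there exist an open neighborhood V ⊆ U of (a,b) and a continuous map g : ℝ^p × ℝ^q → ℝ^p such that the map Ψ(x,y) := (x, φ²(x,y)) is injective on V and φ(x,y) = (g(x, φ²(x,y)), φ²(x,y)) for every (x,y) ∈ V. (Equivalently, φ = ξ ∘ Ψ on V, where ξ(x,z) = (g(x,z), z) preserves the second coordinate and Ψ preserves the first coordinate.) -/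
/-- A continuous linear map `(u, v) ↦ (u, L (u, v))` is bijective as soon as `v ↦ L (0, v)` is. -/
theorem bijective_fst_prod {E F G : Type*} [NormedAddCommGroup E] [NormedSpace ℝ E]
    [NormedAddCommGroup F] [NormedSpace ℝ F] [NormedAddCommGroup G] [NormedSpace ℝ G]
    (L : E × F →L[ℝ] G) (hL : Function.Bijective (fun v : F => L (0, v))) :
    Function.Bijective ((ContinuousLinearMap.fst ℝ E F).prod L) := by
  have split (u : E) (v : F) : L (u, v) = L (u, 0) + L (0, v) := by
    rw [← map_add, Prod.mk_add_mk, add_zero, zero_add]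
  constructor
  · rintro ⟨u, v⟩ ⟨u', v'⟩ h
    obtain ⟨rfl, h⟩ : u = u' ∧ L (u, v) = L (u', v') := by simpa using h
    rw [split u v, split u v', add_right_inj] at h
    rw [hL.1 h]
  · rintro ⟨u, w⟩
    obtain ⟨v, hv⟩ := hL.2 (w - L (u, 0))
    have hv' : L (0, v) = w - L (u, 0) := hv
    exact ⟨(u, v), by simp [split u v, hv']⟩

/-- A function continuous on a closed set of a normal space, with values in a space with the
Tietze extension property, agrees on that set with a globally continuous function. -/
theorem ContinuousOn.exists_continuous_eqOn.{u, v} {X : Type u} {Y : Type v}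
    [TopologicalSpace X] [NormalSpace X] [TopologicalSpace Y] [TietzeExtension.{u, v} Y]
    {f : X → Y} {s : Set X} (hf : ContinuousOn f s) (hs : IsClosed s) :
    ∃ g : X → Y, Continuous g ∧ Set.EqOn g f s := by
  obtain ⟨g, hg⟩ := ContinuousMap.exists_restrict_eq hs ⟨s.domRestrict f, hf.domRestrict⟩
  exact ⟨g, g.continuous, fun x hx => DFunLike.congr_fun hg ⟨x, hx⟩⟩

/-- If `φ = (φ¹, φ²) : U ⊆ ℝ^p × ℝ^q → ℝ^p × ℝ^q` is `C¹` and the partial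
derivative of `φ²` in the second variable at `(a,b) ∈ U` is an invertible linear map of `ℝ^q`,
then `φ` is locally `p`-decomposable at `(a,b)`. -/
theorem stmt_0 (p q : ℕ) (hp : 0 < p) (hq : 0 < q)
    (U : Set ((Fin p → ℝ) × (Fin q → ℝ))) (hU : IsOpen U)
    (φ : ((Fin p → ℝ) × (Fin q → ℝ)) → ((Fin p → ℝ) × (Fin q → ℝ)))
    (hφ : ContDiffOn ℝ 1 φ U)
    (a : Fin p → ℝ) (b : Fin q → ℝ) (hab : (a, b) ∈ U)
    (hinv : Function.Bijective (fun v : Fin q → ℝ => (fderiv ℝ φ (a, b) (0, v)).2)) :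
    ∃ V : Set ((Fin p → ℝ) × (Fin q → ℝ)), IsOpen V ∧ (a, b) ∈ V ∧ V ⊆ U ∧
      ∃ g : ((Fin p → ℝ) × (Fin q → ℝ)) → (Fin p → ℝ), Continuous g ∧
        Set.InjOn (fun z => (z.1, (φ z).2)) V ∧
        ∀ z ∈ V, φ z = (g (z.1, (φ z).2), (φ z).2) := by
  have hφat : ContDiffAt ℝ 1 φ (a, b) := hφ.contDiffAt (hU.mem_nhds hab)
  have hΨ : ContDiffAt ℝ 1 (fun z => (z.1, (φ z).2)) (a, b) := contDiffAt_fst.prodMk hφat.snd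
  have hφd : HasFDerivAt φ (fderiv ℝ φ (a, b)) (a, b) :=
    (hφat.differentiableAt one_ne_zero).hasFDerivAt
  let L := (ContinuousLinearMap.snd ℝ (Fin p → ℝ) (Fin q → ℝ)).comp (fderiv ℝ φ (a, b))
  let D : ((Fin p → ℝ) × (Fin q → ℝ)) ≃L[ℝ] ((Fin p → ℝ) × (Fin q → ℝ)) :=
    (LinearEquiv.ofBijective ((ContinuousLinearMap.fst ℝ _ _).prod L).toLinearMap
      (bijective_fst_prod L hinv)).toContinuousLinearEquiv
  have hD : HasFDerivAt (fun z => (z.1, (φ z).2))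
      (D : ((Fin p → ℝ) × (Fin q → ℝ)) →L[ℝ] ((Fin p → ℝ) × (Fin q → ℝ))) (a, b) :=
    hasFDerivAt_fst.prodMk hφd.snd
  let e := hΨ.toOpenPartialHomeomorph _ hD one_ne_zero
  have hsrc : (a, b) ∈ e.source := hΨ.mem_toOpenPartialHomeomorph_source hD one_ne_zero
  have hW : e.target ∩ e.symm ⁻¹' U ∈ nhds (e (a, b)) :=
    (e.isOpen_inter_preimage_symm hU).mem_nhds
      ⟨e.map_source hsrc, by simpa [e.left_inv hsrc] using hab⟩
  obtain ⟨r, hr, hrW⟩ := Metric.nhds_basis_closedBall.mem_iff.1 hW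
  have hcont : ContinuousOn (fun w => (φ (e.symm w)).1) (Metric.closedBall (e (a, b)) r) :=
    continuous_fst.comp_continuousOn <| hφ.continuousOn.comp
      (e.continuousOn_symm.mono fun w hw => (hrW hw).1) fun w hw => (hrW hw).2
  obtain ⟨g, hg, hgeq⟩ := hcont.exists_continuous_eqOn Metric.isClosed_closedBall
  refine ⟨(e.source ∩ e ⁻¹' Metric.ball (e (a, b)) r) ∩ U,
    (e.isOpen_inter_preimage Metric.isOpen_ball).inter hU,
    ⟨⟨hsrc, Metric.mem_ball_self hr⟩, hab⟩, Set.inter_subset_right, g, hg,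
    e.injOn.mono fun z hz => hz.1.1, fun z hz => Prod.ext ?_ rfl⟩
  have h := hgeq (Metric.ball_subset_closedBall hz.1.2)
  simp only [e.left_inv hz.1.1] at h
  exact h.symm
end

section
/- Let 0 < ε < π/2 and let p : ℕ → ℝ be a sequence with π/2 + nπ - ε/2ⁿ < p(n) < π/2 + nπ for every n ∈ ℕ. Let Z : ℝ → ℝ be any function such that Z(t) = p(n) whenever t ∈ [p(n), (2n+1)π - p(n)) for some n ∈ ℕ, and Z(t) = t whenever t lies in none of these intervals. Then cos(Z(t)) ≠ 0 for every t ≥ 0. -/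
open Real

/-- The jump construction for the rotation flow: if `p n` lies in
`(π/2 + nπ - ε/2ⁿ, π/2 + nπ)` and `Z` freezes at the value `p n` on the interval
`[p n, (2n+1)π - p n)` and equals the identity elsewhere, then `cos (Z t) ≠ 0` for all
`t ≥ 0`, i.e. the modified rotation flow is `1`-decomposable for all times. -/
theorem stmt_6 (ε : ℝ) (hε0 : 0 < ε) (hε : ε < π / 2) (p : ℕ → ℝ)
    (hp : ∀ n : ℕ, π / 2 + n * π - ε / 2 ^ n < p n ∧ p n < π / 2 + n * π)
    (Z : ℝ → ℝ)
    (hZfreeze : ∀ n : ℕ, ∀ t ∈ Set.Ico (p n) ((2 * n + 1) * π - p n), Z t = p n)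
    (hZid : ∀ t : ℝ, (∀ n : ℕ, t ∉ Set.Ico (p n) ((2 * n + 1) * π - p n)) → Z t = t) :
    ∀ t : ℝ, 0 ≤ t → Real.cos (Z t) ≠ 0 := by
  intro t ht hcos
  obtain ⟨k, hk⟩ := Real.cos_eq_zero_iff.mp hcos
  have hpi := Real.pi_pos
  by_cases h : ∃ n : ℕ, t ∈ Set.Ico (p n) ((2 * n + 1) * π - p n)
  · obtain ⟨n, hn⟩ := h
    rw [hZfreeze n t hn] at hk
    obtain ⟨hlow, hupp⟩ := hp n
    have hdiv : ε / 2 ^ n ≤ ε := div_le_self hε0.le (one_le_pow₀ one_le_two)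
    have hkn : (k : ℝ) < n := by
      by_contra! hle
      nlinarith
    have hnk : (n : ℝ) < k + 1 := by
      by_contra! hle
      nlinarith
    have hkn' : k < (n : ℤ) := by exact_mod_cast hkn
    have hnk' : (n : ℤ) < k + 1 := by exact_mod_cast hnk
    omega
  · push Not at h
    rw [hZid t h] at hk
    have hk0 : 0 ≤ k := by
      by_contra! hneg
      have hle : (k : ℝ) ≤ -1 := by exact_mod_cast Int.le_sub_one_of_lt hneg
      nlinarith
    lift k to ℕ using hk0
    push_cast at hk
    have hupp := (hp k).2
    exact h k ⟨by linarith, by linarith⟩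
end

section
/- Let P ⊆ ℝ be closed and A ⊆ ℝ open with P ⊆ A and 0 ∉ A. Then there exists a nondecreasing function σ : [0,∞) → ℝ with σ(0) = 0 such that for every t ≥ 0: σ(t) ≤ t, σ(t) ∉ P, and σ(t) = t whenever t ∉ A. -/
/-- The deterministic core of the `stop and go' technique: given a closed
set `P ⊆ ℝ` of bad times, an open set `A ⊇ P` with `0 ∉ A`, there is a nondecreasing time
change `σ` on `[0,∞)` with `σ 0 = 0` such that `σ t ≤ t`, `σ t` never lies in `P`, and
`σ t = t` whenever `t ∉ A`. -/
theorem stmt_9 (P A : Set ℝ) (hP : IsClosed P) (hA : IsOpen A) (hPA : P ⊆ A)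
    (h0 : (0 : ℝ) ∉ A) :
    ∃ σ : ℝ → ℝ, MonotoneOn σ (Set.Ici 0) ∧ σ 0 = 0 ∧
      ∀ t : ℝ, 0 ≤ t → σ t ≤ t ∧ σ t ∉ P ∧ (t ∉ A → σ t = t) := by
  have hmem : ∀ t : ℝ, 0 ≤ t → sSup (Aᶜ ∩ Set.Icc 0 t) ∈ Aᶜ ∩ Set.Icc 0 t := fun t ht =>
    (isCompact_Icc.inter_left hA.isClosed_compl).sSup_mem ⟨0, h0, le_rfl, ht⟩
  have hbdd : ∀ t : ℝ, BddAbove (Aᶜ ∩ Set.Icc 0 t) := fun t =>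
    bddAbove_Icc.mono Set.inter_subset_right
  refine ⟨fun t => sSup (Aᶜ ∩ Set.Icc 0 t), fun s hs t _ hst => ?_, ?_, fun t ht =>
    ⟨(hmem t ht).2.2, fun h => (hmem t ht).1 (hPA h), fun htA => ?_⟩⟩
  · exact csSup_le_csSup (hbdd t) ⟨0, h0, le_rfl, hs⟩
      (Set.inter_subset_inter_right _ (Set.Icc_subset_Icc_right hst))
  · exact le_antisymm (hmem 0 le_rfl).2.2 (hmem 0 le_rfl).2.1
  · exact le_antisymm (hmem t ht).2.2 (le_csSup (hbdd t) ⟨htA, ht, le_rfl⟩)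
end
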